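/- Let n ≥ 3 and let p₀, p₁, …, p_{n−1}, p_n = p₀ be the successive vertices of a simple closed polygon in ℝ² (consecutive vertices distinct, each side the closed segment [pᵢ, p_{i+1}], sides meeting only at shared endpoints). For each i let ζᵢ ∈ (−π, π) be the signed turning angle at pᵢ, namely the angle of anticlockwise rotation carrying the direction of pᵢ − p_{i−1} to the direction of p_{i+1} − pᵢ (anticlockwise turns counted positive, clockwise negative). If the polygon is traversed in the anticlockwise (positive) orientation then Σᵢ ζᵢ = 2π, and if it is traversed in the clockwise (negative) orientation then Σᵢ ζᵢ = −2π. -/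

import Mathlib

open Real Finset

/-- The signed angle in `(-π, π]` from the vector `u` to the vector `v`. -/
noncomputable def vecAngle (u v : ℂ) : ℝ := Complex.arg (v / u)

theorem vecAngle_neg_neg (u v : ℂ) : vecAngle (-u) (-v) = vecAngle u v := by
  simp [vecAngle, neg_div_neg_eq]

theorem vecAngle_mul_left {c : ℂ} (hc : c ≠ 0) (u v : ℂ) :
    vecAngle (c * u) (c * v) = vecAngle u v := by
  simp [vecAngle, mul_div_mul_left _ _ hc]

theorem vecAngle_smul_left {r : ℝ} (hr : 0 < r) (u v : ℂ) :
    vecAngle ((r : ℂ) * u) v = vecAngle u v := by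
  have : v / ((r : ℂ) * u) = ((r⁻¹ : ℝ) : ℂ) * (v / u) := by
    push_cast
    rw [div_mul_eq_div_div, div_right_comm, div_eq_inv_mul (v / u)]
  rw [vecAngle, this, Complex.arg_real_mul _ (inv_pos.mpr hr), vecAngle]

theorem vecAngle_eq_of_mem_Ioc {u v : ℂ} (hu : u ≠ 0) (hv : v ≠ 0) (k : ℤ)
    (h : Complex.arg v - Complex.arg u + 2 * π * k ∈ Set.Ioc (-π) π) :
    vecAngle u v = Complex.arg v - Complex.arg u + 2 * π * k := by
  have h1 := Real.Angle.toReal_coe_eq_self_iff.mpr ⟨h.1, h.2⟩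
  rw [vecAngle, ← h1, ← Complex.arg_coe_angle_toReal_eq_arg, Complex.arg_div_coe_angle hv hu]
  congr 1
  rw [Real.Angle.coe_add, Real.Angle.coe_sub]
  have : ((2 * π * k : ℝ) : Real.Angle) = 0 := by
    rw [mul_comm, ← zsmul_eq_mul, Real.Angle.coe_zsmul, Real.Angle.coe_two_pi, smul_zero]
  rw [this, add_zero]

theorem vecAngle_of_re_pos {u v : ℂ} (hu : 0 < u.re) (hv : 0 < v.re) :
    vecAngle u v = Complex.arg v - Complex.arg u := by
  have h1 := abs_lt.mp (Complex.abs_arg_lt_pi_div_two_iff.mpr (Or.inl hu))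
  have h2 := abs_lt.mp (Complex.abs_arg_lt_pi_div_two_iff.mpr (Or.inl hv))
  have hu0 : u ≠ 0 := by rintro rfl; simp at hu
  have hv0 : v ≠ 0 := by rintro rfl; simp at hv
  have := vecAngle_eq_of_mem_Ioc hu0 hv0 0 (by push_cast; constructor <;> linarith)
  simpa using this

/-- Angles are additive for vectors in a common open half-plane. -/
theorem vecAngle_add_of_re_mul_pos {c u v w : ℂ} (hu : 0 < (c * u).re) (hv : 0 < (c * v).re)
    (hw : 0 < (c * w).re) : vecAngle u v + vecAngle v w = vecAngle u w := by
  have hc : c ≠ 0 := by rintro rfl; simp at hu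
  rw [← vecAngle_mul_left hc u v, ← vecAngle_mul_left hc v w, ← vecAngle_mul_left hc u w,
    vecAngle_of_re_pos hu hv, vecAngle_of_re_pos hv hw, vecAngle_of_re_pos hu hw]
  ring

theorem vecAngle_add_of_ne_pi {u v : ℂ} (hu : u ≠ 0) (hv : v ≠ 0) (h : vecAngle u v ≠ π) :
    vecAngle u (u + v) + vecAngle (u + v) v = vecAngle u v := by
  obtain ⟨z, rfl⟩ : ∃ z, v = u * z := ⟨v / u, by field_simp⟩
  have hz : z ≠ 0 := right_ne_zero_of_mul hv
  have hz' : z ∈ Complex.slitPlane := by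
    rw [Complex.mem_slitPlane_iff_arg]
    refine ⟨?_, hz⟩
    simpa [vecAngle, mul_div_cancel_left₀ _ hu] using h
  have hn : 0 < ‖z‖ := norm_pos_iff.mpr hz
  have hre : 0 < ‖z‖ + z.re := by
    rcases eq_or_ne z.im 0 with h0 | h0
    · have : 0 < z.re := by
        rcases Complex.mem_slitPlane_iff.mp hz' with h1 | h1
        · exact h1
        · exact absurd h0 h1
      positivity
    · have := Complex.abs_re_lt_norm.mpr h0
      linarith [neg_abs_le z.re]
  have key : z.re * z.re + z.im * z.im = ‖z‖ * ‖z‖ := by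
    rw [← sq ‖z‖, Complex.sq_norm, Complex.normSq_apply]
  have e1 : vecAngle (u * 1) (u * (1 + z)) + vecAngle (u * (1 + z)) (u * z) =
      vecAngle (u * 1) (u * z) := by
    simp only [vecAngle_mul_left hu]
    apply vecAngle_add_of_re_mul_pos (c := ‖z‖ + (starRingEnd ℂ) z)
    · simpa using hre
    · simp; nlinarith
    · simp; nlinarith
  rw [mul_one, mul_add, mul_one] at e1
  exact e1

/-- The total angle around the parallelogram of differences of two disjoint segments vanishes. -/
theorem vecAngle_square {a a' b b' : ℂ} (h : Disjoint (segment ℝ a a') (segment ℝ b b')) :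
    vecAngle (b - a) (b' - a) + vecAngle (b' - a) (b' - a') =
      vecAngle (b - a) (b - a') + vecAngle (b - a') (b' - a') := by
  have hc : ∀ x y : ℂ, IsCompact (segment ℝ x y) := fun x y => by
    rw [segment_eq_image]
    exact isCompact_Icc.image (by fun_prop)
  obtain ⟨f, s, t, hs, hst, ht⟩ := geometric_hahn_banach_compact_closed (convex_segment a a')
    (hc a a') (convex_segment b b') (hc b b').isClosed h
  have hf : ∀ z, f z = (((f 1 : ℂ) - f Complex.I * Complex.I) * z).re := fun z => by
    conv_lhs => rw [← Complex.re_add_im z]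
    have h1 : (z.re : ℂ) + z.im * Complex.I = z.re • (1 : ℂ) + z.im • Complex.I := by simp
    rw [h1, map_add, map_smul, map_smul]
    simp
    ring
  have pos : ∀ x ∈ segment ℝ a a', ∀ y ∈ segment ℝ b b',
      0 < (((f 1 : ℂ) - f Complex.I * Complex.I) * (y - x)).re := fun x hx y hy => by
    rw [← hf, map_sub]
    linarith [hs x hx, ht y hy]
  have la := left_mem_segment ℝ a a'
  have ra := right_mem_segment ℝ a a'
  have lb := left_mem_segment ℝ b b'
  have rb := right_mem_segment ℝ b b'
  rw [vecAngle_add_of_re_mul_pos (pos a la b lb) (pos a la b' rb) (pos a' ra b' rb),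
    vecAngle_add_of_re_mul_pos (pos a la b lb) (pos a' ra b lb) (pos a' ra b' rb)]

/-- The argument with branch cut along the downward vertical ray. -/
noncomputable def downArg (z : ℂ) : ℝ := Complex.arg (-Complex.I * z)

theorem downArg_mem_of_re_neg {z : ℂ} (h : z.re < 0) : downArg z ∈ Set.Ioo 0 π := by
  constructor
  · have h1 : 0 ≤ downArg z := Complex.arg_nonneg_iff.mpr (by simp; linarith)
    refine lt_of_le_of_ne h1 fun h0 => ?_
    have := (Complex.arg_eq_zero_iff.mp h0.symm).2
    simp at this
    linarith
  · refine lt_of_le_of_ne (Complex.arg_le_pi _) fun h0 => ?_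
    have := (Complex.arg_eq_pi_iff.mp h0).2
    simp at this
    linarith

theorem downArg_mem_of_re_pos {z : ℂ} (h : 0 < z.re) : downArg z ∈ Set.Ioo (-π) 0 :=
  ⟨Complex.neg_pi_lt_arg _, Complex.arg_neg_iff.mpr (by simpa using h)⟩

theorem norm_mul_sin_downArg_sub (u v : ℂ) :
    ‖u‖ * ‖v‖ * sin (downArg v - downArg u) = u.re * v.im - u.im * v.re := by
  have s := fun z : ℂ => Complex.norm_mul_sin_arg (-Complex.I * z)
  have c := fun z : ℂ => Complex.norm_mul_cos_arg (-Complex.I * z)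
  have n : ∀ z : ℂ, ‖-Complex.I * z‖ = ‖z‖ := by simp
  simp only [n] at s c
  have su := s u
  have sv := s v
  have cu := c u
  have cv := c v
  simp at su sv cu cv
  rw [sin_sub]
  simp only [downArg, neg_mul]
  linear_combination (‖u‖ * cos (-(Complex.I * u)).arg) * sv + (-v.re) * cu
    - (‖u‖ * sin (-(Complex.I * u)).arg) * cv - v.im * su

/-- Height above the origin at which the line through `u` and `v` meets the imaginary axis. -/
noncomputable def axisHeight (u v : ℂ) : ℝ := u.im - u.re * (v.im - u.im) / (v.re - u.re)

/-- The signed number of times the step from `u` to `v` passes from the left to the right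
closed half-plane. -/
noncomputable def crossSign (u v : ℂ) : ℝ :=
  (if 0 < v.re then 1 else 0) - (if 0 < u.re then 1 else 0)

theorem axisHeight_mul {u v : ℂ} (h : u.re ≠ v.re) :
    axisHeight u v * (v.re - u.re) = -(u.re * v.im - u.im * v.re) := by
  have : v.re - u.re ≠ 0 := sub_ne_zero.mpr h.symm
  rw [axisHeight]
  field_simp
  ring

theorem vecAngle_eq_downArg {u v : ℂ} (hu : u.re ≠ 0) (hv : v.re ≠ 0)
    (h : crossSign u v ≠ 0 → axisHeight u v ≠ 0) :
    vecAngle u v = downArg v - downArg u +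
      2 * π * (crossSign u v * if axisHeight u v < 0 then 1 else 0) := by
  have hu0 : u ≠ 0 := by rintro rfl; simp at hu
  have hv0 : v ≠ 0 := by rintro rfl; simp at hv
  have hI : -Complex.I ≠ 0 := by simp
  have main : ∀ k : ℤ, downArg v - downArg u + 2 * π * k ∈ Set.Ioc (-π) π →
      vecAngle u v = downArg v - downArg u + 2 * π * k := fun k hk => by
    rw [← vecAngle_mul_left hI]
    exact vecAngle_eq_of_mem_Ioc (mul_ne_zero hI hu0) (mul_ne_zero hI hv0) k hk
  have hsin := norm_mul_sin_downArg_sub u v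
  have hn : 0 < ‖u‖ * ‖v‖ := by positivity
  rcases lt_or_gt_of_ne hu with h1 | h1 <;> rcases lt_or_gt_of_ne hv with h2 | h2
  · have a := downArg_mem_of_re_neg h1
    have b := downArg_mem_of_re_neg h2
    have := main 0 (by push_cast; constructor <;> linarith [a.1, a.2, b.1, b.2])
    rw [this]; simp [crossSign, h1.not_gt, h2.not_gt]
  · have a := downArg_mem_of_re_neg h1
    have b := downArg_mem_of_re_pos h2
    have hc : crossSign u v = 1 := by simp [crossSign, h1.not_gt, h2]
    have hm := axisHeight_mul (u := u) (v := v) (by linarith)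
    rw [← hsin] at hm
    rw [hc] at h ⊢
    rcases lt_or_gt_of_ne (h one_ne_zero) with h3 | h3
    · rw [if_pos h3]
      have hs : 0 < sin (downArg v - downArg u) := by
        by_contra! hs
        nlinarith
      have : downArg v - downArg u < -π := by
        by_contra! h4
        have := sin_nonpos_of_nonpos_of_neg_pi_le (by linarith [a.1, b.2]) h4
        linarith
      have := main 1 (by push_cast; constructor <;> linarith [a.1, a.2, b.1, b.2])
      rw [this]; simp
    · rw [if_neg h3.not_gt]
      have hs : sin (downArg v - downArg u) < 0 := by
        by_contra! hs
        have := mul_nonneg hn.le hs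
        nlinarith
      have : -π < downArg v - downArg u := by
        by_contra! h4
        have := sin_nonneg_of_nonneg_of_le_pi (x := downArg v - downArg u + 2 * π)
          (by linarith [a.2, b.1]) (by linarith)
        rw [sin_add_two_pi] at this
        linarith
      have := main 0 (by push_cast; constructor <;> linarith [a.1, a.2, b.1, b.2])
      rw [this]; simp
  · have a := downArg_mem_of_re_pos h1
    have b := downArg_mem_of_re_neg h2
    have hc : crossSign u v = -1 := by simp [crossSign, h2.not_gt, h1]
    have hm := axisHeight_mul (u := u) (v := v) (by linarith)
    rw [← hsin] at hm
    rw [hc] at h ⊢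
    rcases lt_or_gt_of_ne (h (by norm_num)) with h3 | h3
    · rw [if_pos h3]
      have hs : sin (downArg v - downArg u) < 0 := by
        by_contra! hs
        have := mul_nonneg hn.le hs
        nlinarith
      have : π < downArg v - downArg u := by
        by_contra! h4
        have := sin_nonneg_of_nonneg_of_le_pi (by linarith [a.2, b.1]) h4
        linarith
      have := main (-1) (by push_cast; constructor <;> linarith [a.1, a.2, b.1, b.2])
      rw [this]; simp
    · rw [if_neg h3.not_gt]
      have hs : 0 < sin (downArg v - downArg u) := by
        by_contra! hs
        nlinarith
      have : downArg v - downArg u < π := by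
        by_contra! h4
        have := sin_nonpos_of_nonpos_of_neg_pi_le (x := downArg v - downArg u - 2 * π)
          (by linarith [a.1, b.2]) (by linarith)
        rw [sin_sub_two_pi] at this
        linarith
      have := main 0 (by push_cast; constructor <;> linarith [a.1, a.2, b.1, b.2])
      rw [this]; simp
  · have a := downArg_mem_of_re_pos h1
    have b := downArg_mem_of_re_pos h2
    have := main 0 (by push_cast; constructor <;> linarith [a.1, a.2, b.1, b.2])
    rw [this]; simp [crossSign, h1, h2]

theorem downArg_sub_of_opposite {u v : ℂ} {r : ℝ} (hr : 0 < r) (h : v = -((r : ℂ) * u))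
    (hu : u.re ≠ 0) : downArg u - downArg v = crossSign u v * π := by
  have e : downArg v = Complex.arg (-(-Complex.I * u)) := by
    rw [downArg, h, ← Complex.arg_real_mul (-(-Complex.I * u)) hr]
    congr 1
    ring
  have hv : v.re = -(r * u.re) := by simp [h]
  rcases lt_or_gt_of_ne hu with h1 | h1
  · have h2 : 0 < v.re := by nlinarith
    rw [e, Complex.arg_neg_eq_arg_sub_pi_of_im_pos (by simpa using h1), downArg]
    simp [crossSign, h1.not_gt, h2]
  · have h2 : v.re < 0 := by nlinarith
    rw [e, Complex.arg_neg_eq_arg_add_pi_of_im_neg (by simpa using h1), downArg]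
    simp [crossSign, h1, h2.not_gt]

/-- The sum of the first `n` values of an `n`-periodic function is invariant under shifts. -/
theorem sum_range_shift_of_periodic {g : ℕ → ℝ} {n : ℕ} (hg : ∀ i, g (i + n) = g i) (k : ℕ) :
    ∑ i ∈ range n, g (i + k) = ∑ i ∈ range n, g i := by
  induction k with
  | zero => rfl
  | succ k ih =>
    rw [← ih]
    have h1 := sum_range_succ (fun i => g (i + k)) n
    have h2 := sum_range_succ' (fun i => g (i + k)) n
    have h3 := hg k
    simp only [zero_add, add_right_comm _ 1 k, ← add_assoc] at h1 h2 ⊢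
    rw [add_comm n k] at h1
    linarith

/-- The vertices `p 0, …, p (n - 1)`, repeated periodically, form a simple closed polygon. -/
structure IsSimplePolygon (n : ℕ) (p : ℕ → ℂ) : Prop where
  three_le : 3 ≤ n
  periodic : ∀ i, p (i + n) = p i
  ne_succ : ∀ i, p (i + 1) ≠ p i
  disjoint : ∀ i d, 2 ≤ d → d + 2 ≤ n →
    Disjoint (segment ℝ (p i) (p (i + 1))) (segment ℝ (p (i + d)) (p (i + d + 1)))
  eq_of_mem : ∀ i, ∀ x ∈ segment ℝ (p i) (p (i + 1)),
    x ∈ segment ℝ (p (i + 1)) (p (i + 2)) → x = p (i + 1)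
  turn_ne_pi : ∀ i, vecAngle (p (i + 1) - p i) (p (i + 2) - p (i + 1)) ≠ π

/-- The sum of the turning angles of a polygon with `n` vertices. -/
noncomputable def turningSum (n : ℕ) (p : ℕ → ℂ) : ℝ :=
  ∑ i ∈ range n, vecAngle (p (i + 1) - p i) (p (i + 2) - p (i + 1))

namespace IsSimplePolygon

variable {n : ℕ} {p : ℕ → ℂ}

theorem shift (h : IsSimplePolygon n p) (k : ℕ) : IsSimplePolygon n fun i => p (i + k) where
  three_le := h.three_le
  periodic i := by rw [add_right_comm, h.periodic]
  ne_succ i := by rw [add_right_comm]; exact h.ne_succ _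
  disjoint i d := by
    simpa only [add_right_comm _ _ k] using h.disjoint (i + k) d
  eq_of_mem i := by
    simpa only [add_right_comm _ _ k] using h.eq_of_mem (i + k)
  turn_ne_pi i := by
    simpa only [add_right_comm _ _ k] using h.turn_ne_pi (i + k)

theorem turningSum_shift (h : IsSimplePolygon n p) (k : ℕ) :
    turningSum n (fun i => p (i + k)) = turningSum n p := by
  simp only [turningSum, add_right_comm _ _ k]
  exact sum_range_shift_of_periodic
    (g := fun i => vecAngle (p (i + 1) - p i) (p (i + 2) - p (i + 1)))
    (fun i => by simp only [add_right_comm _ n, h.periodic]) k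

theorem turn_eq (h : IsSimplePolygon n p) (i : ℕ) :
    vecAngle (p (i + 1) - p i) (p (i + 2) - p i) +
      vecAngle (p (i + 2) - p i) (p (i + 2) - p (i + 1)) =
      vecAngle (p (i + 1) - p i) (p (i + 2) - p (i + 1)) := by
  have := vecAngle_add_of_ne_pi (sub_ne_zero.mpr (h.ne_succ i))
    (sub_ne_zero.mpr (h.ne_succ (i + 1))) (h.turn_ne_pi i)
  rwa [show p (i + 1) - p i + (p (i + 1 + 1) - p (i + 1)) = p (i + 2) - p i by ring_nf] at this

theorem sum_column (h : IsSimplePolygon n p) (a m j : ℕ) (hj : a + m < j) (hjn : j + 2 ≤ n + a) :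
    ∑ i ∈ range m, vecAngle (p (j + 1) - p (a + i)) (p (j + 1) - p (a + i + 1)) +
        vecAngle (p j - p a) (p (j + 1) - p a) =
      ∑ i ∈ range m, vecAngle (p j - p (a + i)) (p j - p (a + i + 1)) +
        vecAngle (p j - p (a + m)) (p (j + 1) - p (a + m)) := by
  induction m with
  | zero => simp
  | succ m ih =>
    have ih := ih (by omega)
    have hd := h.disjoint (a + m) (j - (a + m)) (by omega) (by omega)
    rw [show a + m + (j - (a + m)) = j by omega] at hd
    have := vecAngle_square hd
    rw [sum_range_succ, sum_range_succ, ← add_assoc a m 1]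
    linarith

theorem sum_turn_eq (h : IsSimplePolygon n p) (k : ℕ) (hk : k + 2 ≤ n) :
    ∑ i ∈ range k, vecAngle (p (i + 1) - p i) (p (i + 2) - p (i + 1)) =
      ∑ j ∈ range k, vecAngle (p (j + 1) - p 0) (p (j + 2) - p 0) +
        ∑ i ∈ range k, vecAngle (p (k + 1) - p i) (p (k + 1) - p (i + 1)) := by
  induction k with
  | zero => simp
  | succ k ih =>
    have ih := ih (by omega)
    have hc := h.sum_column 0 k (k + 1) (by omega) (by omega)
    simp only [zero_add] at hc
    have ht := h.turn_eq k
    rw [sum_range_succ, sum_range_succ _ k, sum_range_succ _ k]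
    simp only [add_assoc, Nat.reduceAdd] at hc ih ht ⊢
    linarith

/-- Hopf's formula: the turning angles sum to twice the angle swept out by the polygon as seen
from a vertex, plus twice the turning angle there. -/
theorem turningSum_eq (h : IsSimplePolygon (n + 2) p) :
    turningSum (n + 2) p =
      2 * (∑ j ∈ range n, vecAngle (p (j + 1) - p 0) (p (j + 2) - p 0) +
        vecAngle (p 0 - p (n + 1)) (p 1 - p 0)) := by
  obtain ⟨m, rfl⟩ : ∃ m, n = m + 1 := ⟨n - 1, by have := h.three_le; omega⟩
  have e0 : p (m + 3) = p 0 := by simpa using h.periodic 0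
  have e1 : p (m + 4) = p 1 := by have := h.periodic 1; rwa [add_comm] at this
  have hs := h.sum_turn_eq (m + 1) (by omega)
  have hc := h.sum_column 1 m (m + 2) (by omega) (by omega)
  have ht := h.turn_eq (m + 1)
  have hl : vecAngle (p (m + 2) - p 0) (p (m + 2) - p 1) +
      vecAngle (p (m + 2) - p 1) (p 0 - p 1) = vecAngle (p 0 - p (m + 2)) (p 1 - p 0) := by
    have hne := h.ne_succ (m + 2)
    have hpi := h.turn_ne_pi (m + 2)
    simp only [add_assoc, Nat.reduceAdd, e0, e1] at hne hpi
    rw [← vecAngle_neg_neg, neg_sub, neg_sub] at hpi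
    have := vecAngle_add_of_ne_pi (sub_ne_zero.mpr hne.symm)
      (sub_ne_zero.mpr (h.ne_succ 0).symm) hpi
    simp only [zero_add, sub_add_sub_cancel] at this
    rw [this, ← vecAngle_neg_neg, neg_sub, neg_sub]
  have hD : ∀ i, vecAngle (p (m + 3) - p (1 + i)) (p (m + 3) - p (1 + i + 1)) =
      vecAngle (p (i + 1) - p 0) (p (i + 2) - p 0) := fun i => by
    rw [e0, ← vecAngle_neg_neg, neg_sub, neg_sub, add_comm 1 i]
  have hD' : ∑ i ∈ range (m + 1), vecAngle (p (m + 2) - p i) (p (m + 2) - p (i + 1)) =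
      ∑ i ∈ range m, vecAngle (p (m + 2) - p (1 + i)) (p (m + 2) - p (1 + i + 1)) +
        vecAngle (p (m + 2) - p 0) (p (m + 2) - p 1) := by
    simp only [sum_range_succ', add_comm 1]
  have hA := sum_range_succ (fun i => vecAngle (p (i + 1) - p 0) (p (i + 2) - p 0)) m
  have hT : turningSum (m + 1 + 2) p =
      ∑ i ∈ range (m + 1), vecAngle (p (i + 1) - p i) (p (i + 2) - p (i + 1)) +
        vecAngle (p (m + 2) - p (m + 1)) (p (m + 3) - p (m + 2)) +
        vecAngle (p 0 - p (m + 2)) (p 1 - p 0) := by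
    rw [turningSum, sum_range_succ, sum_range_succ, e0, ← e0, ← e1]
  have hDm := hD m
  simp only [hD] at hc
  simp only [add_assoc, Nat.reduceAdd, e0, add_comm 1 m] at hc hs ht hD' hDm hT hA ⊢
  rw [hT, hA]
  linarith

theorem eq_vertex_of_mem (h : IsSimplePolygon n p) {i d : ℕ} (hd : 0 < d) (hdn : d < n) {x : ℂ}
    (hx : x ∈ segment ℝ (p i) (p (i + 1)))
    (hx' : x ∈ segment ℝ (p (i + d)) (p (i + d + 1))) : x = p (i + 1) ∨ x = p i := by
  rcases (show d = 1 ∨ d + 1 = n ∨ (2 ≤ d ∧ d + 2 ≤ n) by omega) with rfl | rfl | ⟨h2, h3⟩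
  · exact Or.inl (h.eq_of_mem i x hx hx')
  · right
    have := h.eq_of_mem (i + d) x hx'
    rw [add_assoc i d 1, show i + d + 2 = i + 1 + (d + 1) by ring, h.periodic, h.periodic] at this
    exact this hx
  · exact absurd hx' (Set.disjoint_left.mp (h.disjoint i d h2 h3) hx)

/-- The angle swept out by a polygon as seen from an inner point of one of its sides is half the
sum of the turning angles. -/
theorem turningSum_eq_of_mem_openSegment (h : IsSimplePolygon (n + 2) p) {m : ℂ}
    (hm : m ∈ openSegment ℝ (p (n + 1)) (p 0)) :
    turningSum (n + 2) p = 2 * ∑ j ∈ range (n + 1), vecAngle (p j - m) (p (j + 1) - m) := by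
  have e0 : p (n + 2) = p 0 := by simpa using h.periodic 0
  have e1 : p (n + 3) = p 1 := by have := h.periodic 1; rwa [add_comm] at this
  have hm' := openSegment_subset_segment ℝ _ _ hm
  obtain ⟨a, b, ha, hb, hab, rfl⟩ := hm
  set m := a • p (n + 1) + b • p 0 with hmdef
  have hb' : (b : ℂ) = 1 - a := by rw [← Complex.ofReal_one, ← hab]; simp
  have hpm : p 0 - m = (a : ℂ) * (p 0 - p (n + 1)) := by
    rw [hmdef, Complex.real_smul, Complex.real_smul, hb']; ring
  have hqm : p (n + 1) - m = (b : ℂ) * (p (n + 1) - p 0) := by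
    rw [hmdef, Complex.real_smul, Complex.real_smul, hb']; ring
  have hne : p (n + 1) - p 0 ≠ 0 := by
    rw [← e0]; exact sub_ne_zero.mpr (h.ne_succ (n + 1)).symm
  have hsub : segment ℝ m (p 0) ⊆ segment ℝ (p (n + 1)) (p 0) :=
    (convex_segment _ _).segment_subset hm' (right_mem_segment ℝ _ _)
  have hnot : p (n + 1) ∉ segment ℝ m (p 0) := by
    rintro ⟨s, t, hs, ht, hst, hx⟩
    have ht' : (t : ℂ) = 1 - s := by rw [← Complex.ofReal_one, ← hst]; simp
    rw [Complex.real_smul, Complex.real_smul, ht'] at hx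
    have h0 : ((1 - s * a : ℝ) : ℂ) * (p (n + 1) - p 0) = 0 := by
      push_cast
      linear_combination -hx - (s : ℂ) * hpm
    have h1 : (1 - s * a : ℝ) ≠ 0 := by nlinarith
    exact mul_ne_zero (Complex.ofReal_ne_zero.mpr h1) hne h0
  have hdisj : ∀ j < n, Disjoint (segment ℝ m (p 0)) (segment ℝ (p (j + 1)) (p (j + 2))) := by
    refine fun j hj => Set.disjoint_left.mpr fun x hx hx' => ?_
    have hx1 : x ∈ segment ℝ (p (n + 1)) (p (n + 2)) := by rw [e0]; exact hsub hx
    rcases (show j + 1 = n ∨ j + 2 ≤ n by omega) with rfl | h2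
    · have := h.eq_of_mem (j + 1) x hx' hx1
      exact hnot (this ▸ hx)
    · have := h.disjoint (j + 1) (n - j) (by omega) (by omega)
      rw [show j + 1 + (n - j) = n + 1 by omega] at this
      exact Set.disjoint_left.mp this hx' hx1
  have hsum : ∑ j ∈ range n, vecAngle (p (j + 1) - m) (p (j + 2) - m) =
      ∑ j ∈ range n, vecAngle (p (j + 1) - p 0) (p (j + 2) - p 0) +
        (vecAngle (p 1 - m) (p 1 - p 0) - vecAngle (p (n + 1) - m) (p (n + 1) - p 0)) := by
    have htel := sum_range_sub (fun j => vecAngle (p (j + 1) - m) (p (j + 1) - p 0)) n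
    rw [← neg_sub (vecAngle (p (n + 1) - m) _), ← htel, ← sub_eq_add_neg, ← sum_sub_distrib]
    refine sum_congr rfl fun j hj => ?_
    have := vecAngle_square (hdisj j (mem_range.mp hj))
    linarith
  have hz : vecAngle (p (n + 1) - m) (p (n + 1) - p 0) = 0 := by
    rw [hqm, vecAngle_smul_left hb, vecAngle, div_self hne, Complex.arg_one]
  have hturn : vecAngle (p 0 - m) (p 1 - p 0) = vecAngle (p 0 - p (n + 1)) (p 1 - p 0) := by
    rw [hpm, vecAngle_smul_left ha]
  have htri : vecAngle (p 0 - m) (p 1 - m) + vecAngle (p 1 - m) (p 1 - p 0) =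
      vecAngle (p 0 - m) (p 1 - p 0) := by
    have hpi := h.turn_ne_pi (n + 1)
    simp only [add_assoc, Nat.reduceAdd, e0, e1] at hpi
    have := vecAngle_add_of_ne_pi (u := p 0 - m) (v := p 1 - p 0) ?_
      (sub_ne_zero.mpr (h.ne_succ 0)) (hturn ▸ hpi)
    · simpa only [sub_add_sub_cancel', sub_add_sub_cancel, add_comm] using this
    · rw [hpm]
      exact mul_ne_zero (Complex.ofReal_ne_zero.mpr ha.ne')
        (by rw [← neg_ne_zero, neg_sub]; exact hne)
  rw [h.turningSum_eq, sum_range_succ', hsum]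
  simp only [zero_add]
  linarith

end IsSimplePolygon

/-- If weights `±1` at distinct heights are such that each of them, read from below, starts or
ends a block of partial sums `1`, then the weights alternate and the weighted depths below any
upper bound sum to a nonnegative number. -/
theorem sum_mul_sub_nonneg_of_alternating {ι : Type*} [DecidableEq ι] {s y : ι → ℝ} (T : Finset ι)
    (hs : ∀ k ∈ T, s k = 1 ∨ s k = -1) (hy : Set.InjOn y T)
    (h : ∀ k ∈ T, s k + 2 * ∑ l ∈ T, s l * (if y l < y k then 1 else 0) = 1)
    {M : ℝ} (hM : ∀ k ∈ T, y k ≤ M) : 0 ≤ ∑ k ∈ T, s k * (M - y k) := by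
  induction T using Finset.induction_on_max_value y generalizing M with
  | empty => simp
  | insert a T haT hmax ih =>
    have hlt : ∀ x ∈ T, y x < y a := fun x hx => lt_of_le_of_ne (hmax x hx) fun he =>
      haT (hy (by simp [hx]) (by simp) he ▸ hx)
    have ih := ih (fun k hk => hs k (mem_insert_of_mem hk))
      (hy.mono (by simp)) (fun k hk => by
        have := h k (mem_insert_of_mem hk)
        rw [sum_insert haT, if_neg (hmax k hk).not_gt] at this
        simpa using this) hmax
    have ha := h a (mem_insert_self a T)
    rw [sum_insert haT, if_neg (lt_irrefl _), sum_congr rfl fun x hx => by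
      rw [if_pos (hlt x hx), mul_one]] at ha
    have hMa := hM a (mem_insert_self a T)
    have e : ∑ k ∈ T, s k * (M - y k) = ∑ k ∈ T, s k * (y a - y k) + (∑ k ∈ T, s k) * (M - y a) := by
      rw [sum_mul, ← sum_add_distrib]
      exact sum_congr rfl fun x _ => by ring
    rw [sum_insert haT, e]
    rcases hs a (mem_insert_self a T) with h1 | h1 <;> rw [h1] at ha ⊢
    · have : ∑ k ∈ T, s k = 0 := by linarith
      rw [this]; linarith
    · have : ∑ k ∈ T, s k = 1 := by linarith
      rw [this]; linarith

theorem crossSign_eq_zero_or (u v : ℂ) :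
    crossSign u v = 0 ∨ crossSign u v = 1 ∨ crossSign u v = -1 := by
  rw [crossSign]
  split_ifs <;> simp

theorem mem_openSegment_of_crossSign_ne_zero {a b : ℂ} {c : ℝ} (ha : a.re ≠ c) (hb : b.re ≠ c)
    (h : crossSign (a - c) (b - c) ≠ 0) :
    (c : ℂ) + axisHeight (a - c) (b - c) * Complex.I ∈ openSegment ℝ a b := by
  have key : 0 < (c - a.re) / (b.re - a.re) ∧ (c - a.re) / (b.re - a.re) < 1 ∧
      b.re - a.re ≠ 0 := by
    rcases lt_or_gt_of_ne ha with h1 | h1 <;> rcases lt_or_gt_of_ne hb with h2 | h2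
    · simp [crossSign, h1.not_gt, h2.not_gt] at h
    · have : 0 < b.re - a.re := by linarith
      refine ⟨div_pos (by linarith) this, ?_, this.ne'⟩
      rw [div_lt_one this]; linarith
    · have : b.re - a.re < 0 := by linarith
      refine ⟨div_pos_of_neg_of_neg (by linarith) this, ?_, this.ne⟩
      rw [div_lt_one_of_neg this]; linarith
    · simp [crossSign, h1, h2] at h
  obtain ⟨h1, h2, h3⟩ := key
  have ht : (c - a.re) / (b.re - a.re) * (b.re - a.re) = c - a.re := div_mul_cancel₀ _ h3
  have hh : axisHeight (a - c) (b - c) =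
      a.im + (c - a.re) / (b.re - a.re) * (b.im - a.im) := by
    simp [axisHeight]
    ring
  rw [hh]
  generalize (c - a.re) / (b.re - a.re) = t at h1 h2 ht
  refine ⟨1 - t, t, by linarith, h1, by ring, ?_⟩
  apply Complex.ext
  · simp
    linarith
  · simp
    ring

/-- The height at which the line through `a` and `b` meets the vertical line through `c`. -/
noncomputable def lineHeight (c : ℝ) (a b : ℂ) : ℝ := axisHeight (a - c) (b - c)

theorem integrable_and_integral_crossSign_mul_lineHeight (a b : ℂ) :
    MeasureTheory.Integrable (fun c : ℝ => crossSign (a - c) (b - c) * lineHeight c a b) ∧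
      ∫ c : ℝ, crossSign (a - c) (b - c) * lineHeight c a b =
        (b.re - a.re) * (a.im + b.im) / 2 := by
  have e : (fun c : ℝ => crossSign (a - c) (b - c) * lineHeight c a b) = fun c =>
      (Set.Ico a.re b.re).indicator (fun c => lineHeight c a b) c -
        (Set.Ico b.re a.re).indicator (fun c => lineHeight c a b) c := by
    ext c
    simp only [crossSign, Complex.sub_re, Complex.ofReal_re, sub_pos, Set.indicator, Set.mem_Ico]
    split_ifs <;> first | (exfalso; grind) | simp
  have f : (fun c : ℝ => lineHeight c a b) = fun c =>
      (a.im - a.re * ((b.im - a.im) / (b.re - a.re))) + c * ((b.im - a.im) / (b.re - a.re)) := by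
    ext c
    simp [lineHeight, axisHeight]
    ring
  have hi : ∀ x y : ℝ, MeasureTheory.IntegrableOn (fun c : ℝ => lineHeight c a b) (Set.Ico x y) :=
    fun x y => by
      rw [f]
      exact (Continuous.integrableOn_Icc (by fun_prop)).mono_set Set.Ico_subset_Icc_self
  rw [e]
  have h1 := (hi a.re b.re).integrable_indicator measurableSet_Ico
  have h2 := (hi b.re a.re).integrable_indicator measurableSet_Ico
  refine ⟨h1.sub h2, ?_⟩
  rw [MeasureTheory.integral_sub h1 h2, MeasureTheory.integral_indicator measurableSet_Ico,
    MeasureTheory.integral_indicator measurableSet_Ico, MeasureTheory.integral_Ico_eq_integral_Ioc,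
    MeasureTheory.integral_Ico_eq_integral_Ioc]
  change ∫ c in a.re..b.re, lineHeight c a b = _
  rw [f, intervalIntegral.integral_add (by simp) (by apply Continuous.intervalIntegrable; fun_prop),
    intervalIntegral.integral_mul_const, integral_id, intervalIntegral.integral_const, smul_eq_mul]
  rcases eq_or_ne b.re a.re with h0 | h0
  · simp [h0]
  · have := sub_ne_zero.mpr h0
    field_simp
    ring

namespace IsSimplePolygon

variable {n : ℕ} {p : ℕ → ℂ}

theorem turningSum_eq_crossSign_of_mem_openSegment (h : IsSimplePolygon (n + 2) p) {m : ℂ}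
    (hc : ∀ i, (p i).re ≠ m.re) (hm : m ∈ openSegment ℝ (p (n + 1)) (p 0)) :
    turningSum (n + 2) p = 2 * π * (crossSign (p (n + 1) - m) (p 0 - m) +
      2 * ∑ j ∈ range (n + 1), crossSign (p j - m) (p (j + 1) - m) *
        if axisHeight (p j - m) (p (j + 1) - m) < 0 then 1 else 0) := by
  have e0 : p (n + 2) = p 0 := by simpa using h.periodic 0
  have hm' := openSegment_subset_segment ℝ _ _ hm
  have hre : ∀ i, (p i - m).re ≠ 0 := fun i => by
    rw [Complex.sub_re]; exact sub_ne_zero.mpr (hc i)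
  have hne : ∀ j < n + 1, crossSign (p j - m) (p (j + 1) - m) ≠ 0 →
      axisHeight (p j - m) (p (j + 1) - m) ≠ 0 := fun j hj hs h0 => by
    have hcs : ∀ a b : ℂ, crossSign (a - (m.re : ℂ)) (b - (m.re : ℂ)) = crossSign (a - m) (b - m) :=
      fun a b => by simp [crossSign]
    have hmem := mem_openSegment_of_crossSign_ne_zero (hc j) (hc (j + 1)) (by rwa [hcs])
    have hh : axisHeight (p j - (m.re : ℂ)) (p (j + 1) - (m.re : ℂ)) = m.im := by
      have : axisHeight (p j - (m.re : ℂ)) (p (j + 1) - (m.re : ℂ)) =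
          axisHeight (p j - m) (p (j + 1) - m) + m.im := by
        simp [axisHeight]
        ring
      rw [this, h0, zero_add]
    rw [hh, Complex.re_add_im] at hmem
    have := h.eq_vertex_of_mem (i := j) (d := n + 1 - j) (by omega) (by omega)
      (openSegment_subset_segment ℝ _ _ hmem)
      (by rwa [show j + (n + 1 - j) = n + 1 by omega, e0])
    rcases this with h1 | h1
    · exact hc (j + 1) (congrArg Complex.re h1).symm
    · exact hc j (congrArg Complex.re h1).symm
  have hopp : downArg (p (n + 1) - m) - downArg (p 0 - m) =
      crossSign (p (n + 1) - m) (p 0 - m) * π := by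
    obtain ⟨a, b, ha, hb, hab, hx⟩ := hm
    refine downArg_sub_of_opposite (r := a / b) (by positivity) ?_ (hre _)
    have hb' : (b : ℂ) ≠ 0 := Complex.ofReal_ne_zero.mpr hb.ne'
    have hab' : (a : ℂ) = 1 - b := by rw [← Complex.ofReal_one, ← hab]; simp
    rw [Complex.real_smul, Complex.real_smul, hab'] at hx
    rw [← hx]
    push_cast
    field_simp
    rw [hab']
    ring
  rw [h.turningSum_eq_of_mem_openSegment hm, sum_congr rfl fun j hj =>
    vecAngle_eq_downArg (hre j) (hre (j + 1)) (hne j (mem_range.mp hj)), sum_add_distrib,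
    sum_range_sub (fun j => downArg (p j - m)), ← mul_sum, hopp]
  ring

/-- At a crossing of a vertical line with the polygon, the crossings below it determine the sum
of the turning angles. -/
theorem turningSum_eq_crossSign (h : IsSimplePolygon n p) {c : ℝ} (hc : ∀ i, (p i).re ≠ c) {k : ℕ}
    (hk : crossSign (p k - c) (p (k + 1) - c) ≠ 0) :
    turningSum n p = 2 * π * (crossSign (p k - c) (p (k + 1) - c) +
      2 * ∑ j ∈ range n, crossSign (p j - c) (p (j + 1) - c) *
        if lineHeight c (p j) (p (j + 1)) < lineHeight c (p k) (p (k + 1)) then 1 else 0) := by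
  obtain ⟨N, rfl⟩ : ∃ N, n = N + 2 := ⟨n - 2, by have := h.three_le; omega⟩
  have hk' := mem_openSegment_of_crossSign_ne_zero (hc k) (hc (k + 1)) hk
  set m : ℂ := c + axisHeight (p k - c) (p (k + 1) - c) * Complex.I with hm
  have hmre : m.re = c := by simp [hm]
  have hmim : m.im = lineHeight c (p k) (p (k + 1)) := by simp [hm, lineHeight]
  have hcs : ∀ a b : ℂ, crossSign (a - m) (b - m) = crossSign (a - c) (b - c) :=
    fun a b => by simp [crossSign, hmre]
  have hah : ∀ a b : ℂ, axisHeight (a - m) (b - m) < 0 ↔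
      lineHeight c a b < lineHeight c (p k) (p (k + 1)) := fun a b => by
    have : axisHeight (a - m) (b - m) = lineHeight c a b - m.im := by
      simp [lineHeight, axisHeight, hmre]
      ring
    rw [this, hmim, sub_neg]
  have ek : p (N + 1 + (k + 1)) = p k := by
    rw [show N + 1 + (k + 1) = k + (N + 2) by ring, h.periodic]
  have := (h.shift (k + 1)).turningSum_eq_crossSign_of_mem_openSegment (m := m)
    (fun i => by rw [hmre]; exact hc _) (by simpa only [ek, zero_add] using hk')
  rw [h.turningSum_shift] at this
  simp only [ek, zero_add, hcs, hah] at this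
  rw [this]
  congr 3
  have hshift := sum_range_shift_of_periodic (n := N + 2)
    (g := fun j => crossSign (p j - c) (p (j + 1) - c) *
        if lineHeight c (p j) (p (j + 1)) < lineHeight c (p k) (p (k + 1)) then 1 else 0)
    (fun i => by simp only [add_right_comm _ _ 1, h.periodic]) (k + 1)
  rw [← hshift, sum_range_succ _ (N + 1)]
  have ek' : p (N + 1 + (k + 1) + 1) = p (k + 1) := by
    rw [show N + 1 + (k + 1) + 1 = k + 1 + (N + 2) by ring, h.periodic]
  simp only [ek, ek', lt_irrefl, if_false, mul_zero, add_zero]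
  simp only [add_right_comm _ 1 (k + 1)]

theorem lineHeight_injOn (h : IsSimplePolygon n p) {c : ℝ} (hc : ∀ i, (p i).re ≠ c) :
    Set.InjOn (fun k => lineHeight c (p k) (p (k + 1)))
      {k | k < n ∧ crossSign (p k - c) (p (k + 1) - c) ≠ 0} := by
  have key : ∀ i j, i < j → j < n → crossSign (p i - c) (p (i + 1) - c) ≠ 0 →
      crossSign (p j - c) (p (j + 1) - c) ≠ 0 →
      lineHeight c (p i) (p (i + 1)) ≠ lineHeight c (p j) (p (j + 1)) := by
    intro i j hij hj hi' hj' he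
    have h1 := openSegment_subset_segment ℝ _ _
      (mem_openSegment_of_crossSign_ne_zero (hc i) (hc (i + 1)) hi')
    have h2 := openSegment_subset_segment ℝ _ _
      (mem_openSegment_of_crossSign_ne_zero (hc j) (hc (j + 1)) hj')
    simp only [lineHeight] at he
    rw [← he, show j = i + (j - i) by omega] at h2
    rcases h.eq_vertex_of_mem (by omega) (by omega) h1 h2 with h3 | h3
    · exact hc (i + 1) (by simpa using (congrArg Complex.re h3).symm)
    · exact hc i (by simpa using (congrArg Complex.re h3).symm)
  rintro i ⟨hi, hi'⟩ j ⟨hj, hj'⟩ he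
  rcases lt_trichotomy i j with hlt | heq | hgt
  · exact absurd he (key i j hlt hj hi' hj')
  · exact heq
  · exact absurd he.symm (key j i hgt hi hj' hi')

theorem turningSum_of_sum_crossSign (h : IsSimplePolygon n p) {c : ℝ} (hc : ∀ i, (p i).re ≠ c) :
    (∑ k ∈ range n, crossSign (p k - c) (p (k + 1) - c) * lineHeight c (p k) (p (k + 1)) < 0 →
        turningSum n p = 2 * π) ∧
      (0 < ∑ k ∈ range n, crossSign (p k - c) (p (k + 1) - c) * lineHeight c (p k) (p (k + 1)) →
        turningSum n p = -(2 * π)) := by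
  set s : ℕ → ℝ := fun k => crossSign (p k - c) (p (k + 1) - c) with hs
  set y : ℕ → ℝ := fun k => lineHeight c (p k) (p (k + 1)) with hy
  set T := (range n).filter fun k => s k ≠ 0 with hT
  have hfilter : ∀ g : ℕ → ℝ, ∑ k ∈ range n, s k * g k = ∑ k ∈ T, s k * g k := fun g =>
    (sum_filter_of_ne fun k _ hk => left_ne_zero_of_mul hk).symm
  have hs1 : ∀ k ∈ T, s k = 1 ∨ s k = -1 := fun k hk =>
    (crossSign_eq_zero_or _ _).resolve_left (mem_filter.mp hk).2
  have hinj : Set.InjOn y T := (h.lineHeight_injOn hc).mono fun k hk => by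
    simpa [hT] using hk
  have hkey : ∀ k ∈ T, turningSum n p =
      2 * π * (s k + 2 * ∑ j ∈ T, s j * if y j < y k then 1 else 0) := fun k hk => by
    rw [← hfilter fun j => if y j < y k then 1 else 0]
    exact h.turningSum_eq_crossSign hc (mem_filter.mp hk).2
  have hzero : ∑ k ∈ T, s k = 0 := by
    have h1 := hfilter fun _ => 1
    simp only [mul_one] at h1
    rw [← h1]
    refine (sum_range_sub (fun k => if 0 < (p k - c).re then (1 : ℝ) else 0) n).trans ?_
    have e0 : p n = p 0 := by simpa using h.periodic 0
    rw [e0, sub_self]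
  change (∑ k ∈ range n, s k * y k < 0 → _) ∧ (0 < ∑ k ∈ range n, s k * y k → _)
  rw [hfilter y]
  rcases T.eq_empty_or_nonempty with h0 | hne
  · simp [h0]
  have hpi := two_pi_pos
  obtain ⟨k, hk, hmin⟩ := T.exists_min_image y hne
  obtain ⟨k', hk', hmax⟩ := T.exists_max_image y hne
  have htot := hkey k hk
  rw [sum_eq_zero fun j hj => by rw [if_neg (hmin j hj).not_gt, mul_zero], mul_zero,
    add_zero] at htot
  have hM : ∀ M, ∑ j ∈ T, s j * (M - y j) = -∑ j ∈ T, s j * y j := fun M => by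
    simp only [mul_sub, sum_sub_distrib, ← sum_mul, hzero, zero_mul, zero_sub]
  rcases hs1 k hk with h1 | h1 <;> rw [h1] at htot
  · have := sum_mul_sub_nonneg_of_alternating T hs1 hinj (fun j hj => by
      have := hkey j hj
      rw [htot] at this
      exact (mul_left_cancel₀ hpi.ne' this).symm) hmax
    rw [hM] at this
    exact ⟨fun _ => by linarith, fun _ => by linarith⟩
  · have := sum_mul_sub_nonneg_of_alternating (s := fun j => -s j) T
      (fun j hj => by rcases hs1 j hj with h | h <;> simp [h]) hinj (fun j hj => by
      have := hkey j hj
      rw [htot] at this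
      have := mul_left_cancel₀ hpi.ne' this
      simp only [neg_mul, sum_neg_distrib]
      linarith) hmax
    simp only [neg_mul, sum_neg_distrib, hM] at this
    exact ⟨fun _ => by linarith, fun _ => by linarith⟩

theorem integral_sum_crossSign (h : IsSimplePolygon n p) :
    ∫ c : ℝ, ∑ k ∈ range n, crossSign (p k - c) (p (k + 1) - c) * lineHeight c (p k) (p (k + 1)) =
      -(∑ i ∈ range n, ((p i).re * (p (i + 1)).im - (p (i + 1)).re * (p i).im)) / 2 := by
  rw [MeasureTheory.integral_finsetSum _ fun k _ =>
    (integrable_and_integral_crossSign_mul_lineHeight _ _).1]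
  simp only [(integrable_and_integral_crossSign_mul_lineHeight _ _).2]
  have e0 : p n = p 0 := by simpa using h.periodic 0
  have htel := sum_range_sub (fun k => (p k).re * (p k).im / 2) n
  rw [e0, sub_self] at htel
  rw [← sub_eq_zero, ← htel, ← sum_neg_distrib, sum_div, ← sum_sub_distrib]
  exact sum_congr rfl fun k _ => by ring

/-- **Umlaufsatz for polygons**: the turning angles of a simple polygon sum to `±2π`, with the
sign of the signed area. -/
theorem turningSum_eq_two_pi (h : IsSimplePolygon n p) :
    (0 < ∑ i ∈ range n, ((p i).re * (p (i + 1)).im - (p (i + 1)).re * (p i).im) →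
        turningSum n p = 2 * π) ∧
      (∑ i ∈ range n, ((p i).re * (p (i + 1)).im - (p (i + 1)).re * (p i).im) < 0 →
        turningSum n p = -(2 * π)) := by
  have hint := h.integral_sum_crossSign
  have hae : ∀ᵐ c : ℝ, ∀ i, (p i).re ≠ c := by
    filter_upwards [(Set.countable_range fun i => (p i).re).ae_notMem MeasureTheory.volume]
      with c hc i hi using hc ⟨i, hi⟩
  constructor
  · intro hpos
    by_contra hne
    have : 0 ≤ ∫ c : ℝ, ∑ k ∈ range n,
        crossSign (p k - c) (p (k + 1) - c) * lineHeight c (p k) (p (k + 1)) := by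
      refine MeasureTheory.integral_nonneg_of_ae ?_
      filter_upwards [hae] with c hc
      exact not_lt.mp fun hlt => hne ((h.turningSum_of_sum_crossSign hc).1 hlt)
    linarith
  · intro hneg
    by_contra hne
    have : ∫ c : ℝ, ∑ k ∈ range n,
        crossSign (p k - c) (p (k + 1) - c) * lineHeight c (p k) (p (k + 1)) ≤ 0 := by
      refine MeasureTheory.integral_nonpos_of_ae ?_
      filter_upwards [hae] with c hc
      exact not_lt.mp fun hlt => hne ((h.turningSum_of_sum_crossSign hc).2 hlt)
    linarith

end IsSimplePolygon

/-- Lemma 1 of the paper: for a simple closed polygon in the plane (modelled in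
`ℂ`) with successive vertices `p 0, p 1, …, p (n-1), p n = p 0` (extended
`n`-periodically), consecutive vertices distinct, all vertices within one
period distinct, and sides meeting only at shared endpoints, the signed
turning angles `ζ i ∈ (−π, π)` (the anticlockwise rotation angle carrying the
direction `p (i+1) − p i` to the direction `p (i+2) − p (i+1)`, realised as the
complex argument of the quotient of these differences) sum to `2π` if the
polygon is traversed anticlockwise (positive signed area) and to `−2π` if it is
traversed clockwise (negative signed area). -/
theorem turning_angle_sum (n : ℕ) (hn : 3 ≤ n) (p : ℕ → ℂ)
    (hper : ∀ i, p (i + n) = p i)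
    (hconsec : ∀ i, p (i + 1) ≠ p i)
    (hinj : ∀ i < n, ∀ j < n, p i = p j → i = j)
    (hsides : ∀ i < n, ∀ j < n, i ≠ j →
      segment ℝ (p i) (p (i + 1)) ∩ segment ℝ (p j) (p (j + 1)) ⊆
        {x | ((i + 1) % n = j ∧ x = p j) ∨ ((j + 1) % n = i ∧ x = p i)})
    (ζ : ℕ → ℝ)
    (hζ : ∀ i, ζ i = Complex.arg ((p (i + 2) - p (i + 1)) / (p (i + 1) - p i)))
    (hζrange : ∀ i, ζ i ≠ π) :
    (0 < ∑ i ∈ range n, ((p i).re * (p (i + 1)).im - (p (i + 1)).re * (p i).im) →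
        ∑ i ∈ range n, ζ i = 2 * π) ∧
      (∑ i ∈ range n, ((p i).re * (p (i + 1)).im - (p (i + 1)).re * (p i).im) < 0 →
        ∑ i ∈ range n, ζ i = -(2 * π)) := by
  have hmod : ∀ i, p (i % n) = p i := fun i => by
    conv_rhs => rw [← Nat.mod_add_div i n]
    generalize i / n = k
    induction k with
    | zero => simp
    | succ k ih => rw [mul_add, mul_one, ← add_assoc, hper, ih]
  have hmod' : ∀ i, p (i % n + 1) = p (i + 1) := fun i => by
    rw [← hmod, Nat.mod_add_mod, hmod]
  have hn0 : 0 < n := by omega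
  have key : ∀ i d, 0 < d → d < n → ∀ x ∈ segment ℝ (p i) (p (i + 1)),
      x ∈ segment ℝ (p (i + d)) (p (i + d + 1)) →
      (d = 1 ∧ x = p (i + d)) ∨ (d + 1 = n ∧ x = p i) := by
    intro i d hd hdn x hx hx'
    have hcancel : ∀ e f, e < n → f < n → (i + e) % n = (i + f) % n → e = f :=
      fun e f he hf hef => Nat.ModEq.eq_of_lt_of_lt (Nat.ModEq.add_left_cancel' i hef) he hf
    have hij : i % n ≠ (i + d) % n := fun he => by
      have := hcancel 0 d hn0 hdn he
      omega
    rw [← hmod i, ← hmod' i] at hx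
    rw [← hmod (i + d), ← hmod' (i + d)] at hx'
    rcases hsides _ (Nat.mod_lt i hn0) _ (Nat.mod_lt (i + d) hn0) hij ⟨hx, hx'⟩ with
      ⟨h1, h2⟩ | ⟨h1, h2⟩
    · rw [Nat.mod_add_mod] at h1
      rw [hmod] at h2
      exact Or.inl ⟨(hcancel 1 d (by omega) hdn h1).symm, h2⟩
    · rw [Nat.mod_add_mod, add_assoc] at h1
      rw [hmod] at h2
      refine Or.inr ⟨?_, h2⟩
      by_contra hne
      have := hcancel (d + 1) 0 (by omega) hn0 h1
      omega
  have hP : IsSimplePolygon n p :=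
    { three_le := hn
      periodic := hper
      ne_succ := hconsec
      disjoint := fun i d h2 h3 => Set.disjoint_left.mpr fun x hx hx' => by
        rcases key i d (by omega) (by omega) x hx hx' with h | h <;> omega
      eq_of_mem := fun i x hx hx' => by
        rcases key i 1 (by omega) (by omega) x hx hx' with h | h
        · exact h.2
        · omega
      turn_ne_pi := fun i => by
        rw [vecAngle, ← hζ]
        exact hζrange i }
  have hsum : ∑ i ∈ range n, ζ i = turningSum n p := sum_congr rfl fun i _ => hζ i
  rw [hsum]
  exact hP.turningSum_eq_two_pi
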